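/- arXiv:1908.10400 — 7 statements merged into one kernel-verified Lean document; each statement's English description precedes it below -/
import Mathlib

section
/- For every w, u ∈ ℝ^d, the gradient of the meta-objective F satisfies ‖∇F(w) − ∇F(u)‖ ≤ min{L(w), L(u)} · ‖w − u‖, where L(w) = 4L + 2ρα ∑_{i∈I} p_i ‖∇f_i(w)‖. -/
open scoped RealInnerProductSpace BigOperators

section Smoothness

variable {E : Type*} [NormedAddCommGroup E] [InnerProductSpace ℝ E] [CompleteSpace E]

theorem norm_gradient_sub_gradient (f g : E → ℝ) (x y : E) :
    ‖gradient f x - gradient g y‖ = ‖fderiv ℝ f x - fderiv ℝ g y‖ := by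
  simp only [gradient, ← map_sub, LinearIsometryEquiv.norm_map]

theorem norm_gradient_eq_norm_fderiv (f : E → ℝ) (x : E) :
    ‖gradient f x‖ = ‖fderiv ℝ f x‖ := by
  simp only [gradient, LinearIsometryEquiv.norm_map]

theorem ContDiff.differentiable_gradient {f : E → ℝ} (hf : ContDiff ℝ 2 f) :
    Differentiable ℝ (gradient f) := by
  have h : Differentiable ℝ (fderiv ℝ f) :=
    (hf.fderiv_right (m := 1) (by norm_num)).differentiable (by norm_num)
  exact fun x => (InnerProductSpace.toDual ℝ E).symm.differentiableAt.comp x (h x)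

theorem hasFDerivAt_comp_gradient_step {f : E → ℝ} (hf : ContDiff ℝ 2 f) (α : ℝ) (w : E) :
    HasFDerivAt (fun x => f (x - α • gradient f x))
      ((fderiv ℝ f (w - α • gradient f w)).comp
        (ContinuousLinearMap.id ℝ E - α • fderiv ℝ (gradient f) w)) w :=
  ((hf.differentiable (by norm_num)) _).hasFDerivAt.comp w
    ((hasFDerivAt_id w).sub ((hf.differentiable_gradient w).hasFDerivAt.const_smul α))

/-- The derivative of the objective after one gradient step is Lipschitz, with a constant that
depends on the gradient at one of the two points only. -/
theorem norm_fderiv_comp_gradient_step_sub_le {f : E → ℝ} (hf : ContDiff ℝ 2 f) {L ρ α : ℝ}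
    (hL : 0 < L) (hα0 : 0 ≤ α) (hα : α ≤ 1 / L)
    (hgrad : ∀ w u, ‖gradient f w - gradient f u‖ ≤ L * ‖w - u‖)
    (hhess : ∀ w u, ‖fderiv ℝ (gradient f) w - fderiv ℝ (gradient f) u‖ ≤ ρ * ‖w - u‖)
    (w u : E) :
    ‖fderiv ℝ (fun x => f (x - α • gradient f x)) w
        - fderiv ℝ (fun x => f (x - α • gradient f x)) u‖
      ≤ (4 * L + 2 * ρ * α * ‖gradient f w‖) * ‖w - u‖ := by
  have hαL : α * L ≤ 1 := (le_div_iff₀ hL).mp hα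
  rw [(hasFDerivAt_comp_gradient_step hf α w).fderiv,
    (hasFDerivAt_comp_gradient_step hf α u).fderiv]
  set T : E → E := fun x => x - α • gradient f x with hT
  set A : E → E →L[ℝ] E := fun x => ContinuousLinearMap.id ℝ E - α • fderiv ℝ (gradient f) x
    with hA
  change ‖(fderiv ℝ f (T w)).comp (A w) - (fderiv ℝ f (T u)).comp (A u)‖ ≤ _
  have hH : ‖fderiv ℝ (gradient f) u‖ ≤ L :=
    (hf.differentiable_gradient u).hasFDerivAt.le_of_lip' hL.le
      (Filter.Eventually.of_forall fun x => hgrad x u)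
  have hAu : ‖A u‖ ≤ 2 := by
    calc ‖A u‖ ≤ ‖ContinuousLinearMap.id ℝ E‖ + ‖α • fderiv ℝ (gradient f) u‖ := norm_sub_le _ _
      _ ≤ 1 + α * L := by
        rw [norm_smul, Real.norm_of_nonneg hα0]
        gcongr
        exact ContinuousLinearMap.norm_id_le
      _ ≤ 2 := by linarith
  have hAsub : ‖A w - A u‖ ≤ α * (ρ * ‖w - u‖) := by
    have h : A w - A u = -(α • (fderiv ℝ (gradient f) w - fderiv ℝ (gradient f) u)) := by
      simp only [hA, smul_sub]; abel
    rw [h, norm_neg, norm_smul, Real.norm_of_nonneg hα0]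
    gcongr
    exact hhess w u
  have hTsub : ‖T w - T u‖ ≤ 2 * ‖w - u‖ := by
    have h : T w - T u = (w - u) - α • (gradient f w - gradient f u) := by
      simp only [hT, smul_sub]; abel
    calc ‖T w - T u‖ ≤ ‖w - u‖ + ‖α • (gradient f w - gradient f u)‖ := h ▸ norm_sub_le _ _
      _ ≤ ‖w - u‖ + α * (L * ‖w - u‖) := by
        rw [norm_smul, Real.norm_of_nonneg hα0]
        gcongr
        exact hgrad w u
      _ ≤ 2 * ‖w - u‖ := by nlinarith [norm_nonneg (w - u)]
  have hfsub : ‖fderiv ℝ f (T w) - fderiv ℝ f (T u)‖ ≤ L * (2 * ‖w - u‖) := by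
    rw [← norm_gradient_sub_gradient]
    exact (hgrad _ _).trans (by gcongr)
  have hfT : ‖fderiv ℝ f (T w)‖ ≤ 2 * ‖gradient f w‖ := by
    have h := hgrad (T w) w
    have hTw : ‖T w - w‖ = α * ‖gradient f w‖ := by
      rw [show T w - w = -(α • gradient f w) by simp only [hT]; abel, norm_neg, norm_smul,
        Real.norm_of_nonneg hα0]
    rw [hTw] at h
    rw [← norm_gradient_eq_norm_fderiv]
    nlinarith [norm_le_norm_add_norm_sub' (gradient f (T w)) (gradient f w),
      norm_nonneg (gradient f w)]
  have hsplit : (fderiv ℝ f (T w)).comp (A w) - (fderiv ℝ f (T u)).comp (A u)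
      = (fderiv ℝ f (T w) - fderiv ℝ f (T u)).comp (A u)
        + (fderiv ℝ f (T w)).comp (A w - A u) := by
    rw [ContinuousLinearMap.sub_comp _ _ (A u), ContinuousLinearMap.comp_sub _ (A w) (A u)]
    abel
  calc _ ≤ ‖fderiv ℝ f (T w) - fderiv ℝ f (T u)‖ * ‖A u‖ + ‖fderiv ℝ f (T w)‖ * ‖A w - A u‖ :=
        hsplit ▸ norm_add_le_of_le (ContinuousLinearMap.opNorm_comp_le _ _)
          (ContinuousLinearMap.opNorm_comp_le _ _)
    _ ≤ L * (2 * ‖w - u‖) * 2 + 2 * ‖gradient f w‖ * (α * (ρ * ‖w - u‖)) := by gcongr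
    _ = _ := by ring

end Smoothness

/-- **Smoothness of the MAML objective** (Lemma 2 / `lem_smooth_F`).
For every `w, u ∈ ℝ^d`, the gradient of the meta-objective `F` satisfies
`‖∇F(w) − ∇F(u)‖ ≤ min {L(w), L(u)} · ‖w − u‖`, where
`L(w) = 4L + 2ρα ∑_{i∈I} p_i ‖∇f_i(w)‖`. -/
theorem maml_smoothness_of_F
    {d : ℕ} {ι : Type*} [Fintype ι]
    (p : ι → ℝ) (hp : ∀ i, 0 ≤ p i) (hpsum : ∑ i, p i = 1)
    (f : ι → EuclideanSpace ℝ (Fin d) → ℝ)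
    (L ρ α : ℝ) (hL : 0 < L) (hρ : 0 < ρ) (hα0 : 0 ≤ α) (hα : α ≤ 1 / L)
    (hf : ∀ i, ContDiff ℝ 2 (f i))
    (hgrad : ∀ i w u, ‖gradient (f i) w - gradient (f i) u‖ ≤ L * ‖w - u‖)
    (hhess : ∀ i w u,
      ‖fderiv ℝ (gradient (f i)) w - fderiv ℝ (gradient (f i)) u‖ ≤ ρ * ‖w - u‖)
    (F : EuclideanSpace ℝ (Fin d) → ℝ)
    (hF : ∀ w, F w = ∑ i, p i * f i (w - α • gradient (f i) w))
    (Lw : EuclideanSpace ℝ (Fin d) → ℝ)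
    (hLw : ∀ w, Lw w = 4 * L + 2 * ρ * α * ∑ i, p i * ‖gradient (f i) w‖) :
    ∀ w u, ‖gradient F w - gradient F u‖ ≤ min (Lw w) (Lw u) * ‖w - u‖ := by
  have hfderiv : ∀ w, fderiv ℝ F w
      = ∑ i, p i • fderiv ℝ (fun x => f i (x - α • gradient (f i) x)) w := by
    intro w
    rw [funext hF]
    exact (HasFDerivAt.fun_sum fun i _ => ((hasFDerivAt_comp_gradient_step (hf i) α
      w).differentiableAt.hasFDerivAt.const_mul (p i))).fderiv
  have hle : ∀ w u, ‖gradient F w - gradient F u‖ ≤ Lw w * ‖w - u‖ := by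
    intro w u
    rw [norm_gradient_sub_gradient, hfderiv, hfderiv, ← Finset.sum_sub_distrib]
    calc _ ≤ ∑ i, p i * ((4 * L + 2 * ρ * α * ‖gradient (f i) w‖) * ‖w - u‖) := by
          refine norm_sum_le_of_le _ fun i _ => ?_
          rw [← smul_sub, norm_smul, Real.norm_of_nonneg (hp i)]
          exact mul_le_mul_of_nonneg_left (norm_fderiv_comp_gradient_step_sub_le (hf i) hL hα0 hα
            (hgrad i) (hhess i) w u) (hp i)
      _ = ((∑ i, p i) * (4 * L) + 2 * ρ * α * ∑ i, p i * ‖gradient (f i) w‖) * ‖w - u‖ := by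
          rw [Finset.sum_mul, Finset.mul_sum, ← Finset.sum_add_distrib, Finset.sum_mul]
          exact Finset.sum_congr rfl fun i _ => by ring
      _ = Lw w * ‖w - u‖ := by rw [hpsum, one_mul, hLw]
  intro w u
  rw [min_mul_of_nonneg _ _ (norm_nonneg _)]
  refine le_min (hle w u) ?_
  rw [norm_sub_rev, norm_sub_rev w u]
  exact hle u w
end

section
/- If 0 ≤ α < (√2 − 1)/L, then for every w ∈ ℝ^d one has ‖∇f(w)‖ ≤ C₁ ‖∇F(w)‖ + C₂ σ, where C₁ = 1/(1 − 2αL − α²L²) and C₂ = (2αL + α²L²)/(1 − 2αL − α²L²). -/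
open scoped RealInnerProductSpace BigOperators

section GradientStep

variable {E : Type*} [NormedAddCommGroup E] [InnerProductSpace ℝ E] [CompleteSpace E]

theorem ContDiff.gradient {f : E → ℝ} {m n : WithTop ℕ∞} (hf : ContDiff ℝ n f)
    (hmn : m + 1 ≤ n) : ContDiff ℝ m (gradient f) :=
  (InnerProductSpace.toDual ℝ E).symm.contDiff.comp (hf.fderiv_right hmn)

theorem HasGradientAt.fun_sum_const_mul {ι : Type*} (s : Finset ι) (p : ι → ℝ)
    {f : ι → E → ℝ} {g : ι → E} {w : E} (hf : ∀ i ∈ s, HasGradientAt (f i) (g i) w) :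
    HasGradientAt (fun x => ∑ i ∈ s, p i * f i x) (∑ i ∈ s, p i • g i) w := by
  rw [hasGradientAt_iff_hasFDerivAt]
  have h := HasFDerivAt.fun_sum fun i hi => (hf i hi).hasFDerivAt.const_mul (p i)
  simpa only [map_sum, map_smul] using h

/-- The gradient of `x ↦ f (x - α ∇f x)` is `(1 - α ∇²f w) ∇f (w - α ∇f w)`. -/
theorem hasGradientAt_comp_sub_smul_gradient {f : E → ℝ} (hf : ContDiff ℝ 2 f) (α : ℝ) (w : E) :
    HasGradientAt (fun x => f (x - α • gradient f x))
      (gradient f (w - α • gradient f w) -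
        α • ContinuousLinearMap.adjoint (fderiv ℝ (gradient f) w)
          (gradient f (w - α • gradient f w))) w := by
  have hg : HasFDerivAt (gradient f) (fderiv ℝ (gradient f) w) w :=
    ((hf.gradient (m := 1) (by norm_num)).differentiable (by norm_num) w).hasFDerivAt
  have hf' : HasGradientAt f (gradient f (w - α • gradient f w)) (w - α • gradient f w) :=
    (hf.differentiable (by norm_num) _).hasGradientAt
  rw [hasGradientAt_iff_hasFDerivAt]
  refine (hf'.hasFDerivAt.comp w ((hasFDerivAt_id w).sub (hg.const_smul α))).congr_fderiv ?_
  ext h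
  simp [ContinuousLinearMap.adjoint_inner_left]

theorem norm_gradient_sub_gradient_comp_le {f : E → ℝ} (hf : ContDiff ℝ 2 f) {L α : ℝ}
    (hL : 0 ≤ L) (hα : 0 ≤ α)
    (hgrad : ∀ w u, ‖gradient f w - gradient f u‖ ≤ L * ‖w - u‖) (w : E) :
    ‖gradient f w - gradient (fun x => f (x - α • gradient f x)) w‖ ≤
      (2 * α * L + α ^ 2 * L ^ 2) * ‖gradient f w‖ := by
  rw [(hasGradientAt_comp_sub_smul_gradient hf α w).gradient]
  set y := gradient f (w - α • gradient f w)
  set A := fderiv ℝ (gradient f) w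
  have hA : ‖A‖ ≤ L := by
    have hlip : LipschitzWith L.toNNReal (gradient f) :=
      LipschitzWith.of_dist_le' fun x y => by simpa only [dist_eq_norm] using hgrad x y
    simpa [hL] using norm_fderiv_le_of_lipschitz ℝ hlip (x₀ := w)
  have hy : ‖gradient f w - y‖ ≤ α * L * ‖gradient f w‖ := by
    refine (hgrad _ _).trans_eq ?_
    rw [sub_sub_cancel, norm_smul, Real.norm_of_nonneg hα]
    ring
  have hy' : ‖y‖ ≤ (1 + α * L) * ‖gradient f w‖ := by
    have := norm_le_norm_add_norm_sub (gradient f w) y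
    linarith
  have hAy : ‖ContinuousLinearMap.adjoint A y‖ ≤ L * ((1 + α * L) * ‖gradient f w‖) := by
    refine (ContinuousLinearMap.le_opNorm _ _).trans ?_
    rw [LinearIsometryEquiv.norm_map]
    gcongr
  calc ‖gradient f w - (y - α • ContinuousLinearMap.adjoint A y)‖
      = ‖(gradient f w - y) + α • ContinuousLinearMap.adjoint A y‖ := by congr 1; abel
    _ ≤ ‖gradient f w - y‖ + α * ‖ContinuousLinearMap.adjoint A y‖ := by
        refine (norm_add_le _ _).trans_eq ?_
        rw [norm_smul, Real.norm_of_nonneg hα]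
    _ ≤ α * L * ‖gradient f w‖ + α * (L * ((1 + α * L) * ‖gradient f w‖)) := by gcongr
    _ = (2 * α * L + α ^ 2 * L ^ 2) * ‖gradient f w‖ := by ring

end GradientStep

theorem sum_mul_norm_le_norm_add_of_sum_mul_norm_sub_sq_le {ι E : Type*} [SeminormedAddCommGroup E]
    (s : Finset ι) (p : ι → ℝ) (hp : ∀ i ∈ s, 0 ≤ p i) (hpsum : ∑ i ∈ s, p i = 1)
    (v : ι → E) (m : E) {σ : ℝ} (hσ : 0 ≤ σ) (hvar : ∑ i ∈ s, p i * ‖v i - m‖ ^ 2 ≤ σ ^ 2) :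
    ∑ i ∈ s, p i * ‖v i‖ ≤ ‖m‖ + σ := by
  have hdev : ∑ i ∈ s, p i * ‖v i - m‖ ≤ σ :=
    le_of_sq_le_sq ((Real.pow_arith_mean_le_arith_mean_pow s p (fun i => ‖v i - m‖) hp hpsum
      (fun _ _ => norm_nonneg _) 2).trans hvar) hσ
  calc ∑ i ∈ s, p i * ‖v i‖ ≤ ∑ i ∈ s, p i * (‖m‖ + ‖v i - m‖) :=
        Finset.sum_le_sum fun i hi =>
          mul_le_mul_of_nonneg_left (norm_le_norm_add_norm_sub' _ _) (hp i hi)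
    _ = ‖m‖ + ∑ i ∈ s, p i * ‖v i - m‖ := by
        simp only [mul_add, Finset.sum_add_distrib, ← Finset.sum_mul, hpsum, one_mul]
    _ ≤ ‖m‖ + σ := by gcongr

/-- **Bounding `‖∇f(w)‖` by `‖∇F(w)‖`** (Lemma `lemma_bound_by_F`, first part).
If `0 ≤ α < (√2 − 1)/L`, then for every `w`,
`‖∇f(w)‖ ≤ C₁ ‖∇F(w)‖ + C₂ σ`, with `C₁ = 1/(1 − 2αL − α²L²)` and
`C₂ = (2αL + α²L²)/(1 − 2αL − α²L²)`. -/
theorem grad_f_le_grad_F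
    {d : ℕ} {ι : Type*} [Fintype ι]
    (p : ι → ℝ) (hp : ∀ i, 0 ≤ p i) (hpsum : ∑ i, p i = 1)
    (f : ι → EuclideanSpace ℝ (Fin d) → ℝ)
    (L α σ : ℝ) (hL : 0 < L) (hα0 : 0 ≤ α) (hα : α < (Real.sqrt 2 - 1) / L) (hσ : 0 ≤ σ)
    (hf : ∀ i, ContDiff ℝ 2 (f i))
    (hgrad : ∀ i w u, ‖gradient (f i) w - gradient (f i) u‖ ≤ L * ‖w - u‖)
    (F fbar : EuclideanSpace ℝ (Fin d) → ℝ)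
    (hF : ∀ w, F w = ∑ i, p i * f i (w - α • gradient (f i) w))
    (hfbar : ∀ w, fbar w = ∑ i, p i * f i w)
    (hvar : ∀ w, ∑ i, p i * ‖gradient (f i) w - gradient fbar w‖ ^ 2 ≤ σ ^ 2) :
    ∀ w, ‖gradient fbar w‖ ≤
      (1 / (1 - 2 * α * L - α ^ 2 * L ^ 2)) * ‖gradient F w‖ +
        ((2 * α * L + α ^ 2 * L ^ 2) / (1 - 2 * α * L - α ^ 2 * L ^ 2)) * σ := by
  intro w
  have hc : 0 < 1 - 2 * α * L - α ^ 2 * L ^ 2 := by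
    rw [lt_div_iff₀ hL] at hα
    have hsq : (α * L + 1) ^ 2 < Real.sqrt 2 ^ 2 := by
      have := mul_nonneg hα0 hL.le
      gcongr
      linarith
    rw [Real.sq_sqrt zero_le_two] at hsq
    linarith
  have hfbar' : gradient fbar w = ∑ i, p i • gradient (f i) w := by
    rw [funext hfbar]
    exact (HasGradientAt.fun_sum_const_mul _ p fun i _ =>
      ((hf i).differentiable (by norm_num) w).hasGradientAt).gradient
  have hF' : gradient F w =
      ∑ i, p i • gradient (fun x => f i (x - α • gradient (f i) x)) w := by
    rw [funext hF]
    exact (HasGradientAt.fun_sum_const_mul _ p fun i _ =>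
      (hasGradientAt_comp_sub_smul_gradient (hf i) α w).differentiableAt.hasGradientAt).gradient
  have hdiff : ‖gradient fbar w - gradient F w‖ ≤
      (2 * α * L + α ^ 2 * L ^ 2) * (‖gradient fbar w‖ + σ) := by
    calc ‖gradient fbar w - gradient F w‖
        ≤ ∑ i, p i * ((2 * α * L + α ^ 2 * L ^ 2) * ‖gradient (f i) w‖) := by
          rw [hfbar', hF', ← Finset.sum_sub_distrib]
          refine norm_sum_le_of_le _ fun i _ => ?_
          rw [← smul_sub, norm_smul, Real.norm_of_nonneg (hp i)]
          exact mul_le_mul_of_nonneg_left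
            (norm_gradient_sub_gradient_comp_le (hf i) hL.le hα0 (hgrad i) w) (hp i)
      _ = (2 * α * L + α ^ 2 * L ^ 2) * ∑ i, p i * ‖gradient (f i) w‖ := by
          simp only [Finset.mul_sum, mul_left_comm]
      _ ≤ (2 * α * L + α ^ 2 * L ^ 2) * (‖gradient fbar w‖ + σ) := by
          gcongr
          exact sum_mul_norm_le_norm_add_of_sum_mul_norm_sub_sq_le _ p (fun i _ => hp i) hpsum
            _ _ hσ (hvar w)
  have htri := norm_le_norm_add_norm_sub' (gradient fbar w) (gradient F w)
  rw [div_mul_eq_mul_div, div_mul_eq_mul_div, ← add_div, le_div_iff₀ hc]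
  linarith
end

section
/- The bias of the inner-step stochastic-gradient estimator satisfies ‖E[∇f(w − αg)] − ∇f(w − α∇f(w))‖ ≤ αL σ̃ / √D. -/
open MeasureTheory

/-- On a probability space, the mean of a real function is at most the square root of its second
moment. -/
lemma integral_le_sqrt_integral_sq {Ω : Type*} {mΩ : MeasurableSpace Ω} {μ : Measure Ω}
    [IsProbabilityMeasure μ] {X : Ω → ℝ} (hX : Integrable X μ)
    (hX2 : Integrable (fun ω => X ω ^ 2) μ) :
    ∫ ω, X ω ∂μ ≤ Real.sqrt (∫ ω, X ω ^ 2 ∂μ) :=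
  Real.le_sqrt_of_sq_le <|
    (even_two.convexOn_pow (𝕜 := ℝ)).map_integral_le (by fun_prop) isClosed_univ (by simp) hX hX2

/-- The mean of a Lipschitz function of a random vector deviates from its value at `c` by at most
the Lipschitz constant times the mean distance to `c`. -/
lemma norm_integral_comp_sub_le {Ω E F : Type*} {mΩ : MeasurableSpace Ω} {μ : Measure Ω}
    [IsProbabilityMeasure μ] [NormedAddCommGroup E] [NormedAddCommGroup F] [NormedSpace ℝ F]
    [CompleteSpace F] {K : ℝ} {φ : E → F} (hφ : ∀ x y, ‖φ x - φ y‖ ≤ K * ‖x - y‖)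
    {X : Ω → E} (hX : Integrable X μ) (c : E) :
    ‖(∫ ω, φ (X ω) ∂μ) - φ c‖ ≤ K * ∫ ω, ‖X ω - c‖ ∂μ := by
  have hcont : Continuous φ :=
    (LipschitzWith.of_dist_le' (K := K) fun x y => by
      simpa only [dist_eq_norm] using hφ x y).continuous
  have hdist : Integrable (fun ω => K * ‖X ω - c‖) μ :=
    (hX.sub (integrable_const c)).norm.const_mul K
  have hdiff : Integrable (fun ω => φ (X ω) - φ c) μ :=
    hdist.mono' ((hcont.comp_aestronglyMeasurable hX.aestronglyMeasurable).sub
      aestronglyMeasurable_const) (.of_forall fun ω => hφ (X ω) c)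
  have hcomp : Integrable (fun ω => φ (X ω)) μ :=
    (hdiff.add (integrable_const (φ c))).congr (.of_forall fun _ => sub_add_cancel _ _)
  calc ‖(∫ ω, φ (X ω) ∂μ) - φ c‖ = ‖∫ ω, (φ (X ω) - φ c) ∂μ‖ := by
        rw [integral_sub hcomp (integrable_const _)]; simp
    _ ≤ ∫ ω, K * ‖X ω - c‖ ∂μ :=
        norm_integral_le_of_norm_le hdist (.of_forall fun ω => hφ (X ω) c)
    _ = K * ∫ ω, ‖X ω - c‖ ∂μ := integral_const_mul _ _

/-- **Bias of the inner-step stochastic-gradient estimator** (part of Lemma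
`lemma:moments`): `‖E[∇f(w − αg)] − ∇f(w − α∇f(w))‖ ≤ αLσ̃/√D`. -/
theorem bias_inner_step_estimator
    {d : ℕ} (f : EuclideanSpace ℝ (Fin d) → ℝ)
    (L α σt D : ℝ) (hL : 0 < L) (hα : 0 ≤ α) (hσt : 0 ≤ σt) (hD : 0 < D)
    (hf : ContDiff ℝ 1 f)
    (hgrad : ∀ w u, ‖gradient f w - gradient f u‖ ≤ L * ‖w - u‖)
    (w : EuclideanSpace ℝ (Fin d))
    {Ω : Type*} [MeasureSpace Ω] [IsProbabilityMeasure (volume : Measure Ω)]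
    (g : Ω → EuclideanSpace ℝ (Fin d)) (hgint : Integrable g)
    (hgmean : ∫ ω, g ω = gradient f w)
    (hgsq : Integrable (fun ω => ‖g ω - gradient f w‖ ^ 2))
    (hgvar : ∫ ω, ‖g ω - gradient f w‖ ^ 2 ≤ σt ^ 2 / D) :
    ‖(∫ ω, gradient f (w - α • g ω)) - gradient f (w - α • gradient f w)‖ ≤
      α * L * σt / Real.sqrt D := by
  have hdev : ∫ ω, ‖g ω - gradient f w‖ ≤ σt / Real.sqrt D :=
    calc ∫ ω, ‖g ω - gradient f w‖
        ≤ Real.sqrt (∫ ω, ‖g ω - gradient f w‖ ^ 2) :=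
          integral_le_sqrt_integral_sq (hgint.sub (integrable_const _)).norm hgsq
      _ ≤ Real.sqrt (σt ^ 2 / D) := Real.sqrt_le_sqrt hgvar
      _ = σt / Real.sqrt D := by rw [Real.sqrt_div (sq_nonneg σt), Real.sqrt_sq hσt]
  have hstep (ω : Ω) : ‖w - α • g ω - (w - α • gradient f w)‖ = α * ‖g ω - gradient f w‖ := by
    rw [sub_sub_sub_cancel_left, ← smul_sub, norm_smul, Real.norm_of_nonneg hα, norm_sub_rev]
  calc ‖(∫ ω, gradient f (w - α • g ω)) - gradient f (w - α • gradient f w)‖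
      ≤ L * ∫ ω, ‖w - α • g ω - (w - α • gradient f w)‖ :=
        norm_integral_comp_sub_le hgrad ((integrable_const w).sub (hgint.smul α)) _
    _ = α * L * ∫ ω, ‖g ω - gradient f w‖ := by
        simp only [hstep, integral_const_mul]; ring
    _ ≤ α * L * (σt / Real.sqrt D) := by gcongr
    _ = α * L * σt / Real.sqrt D := by ring
end

section
/- For every w, u ∈ ℝ^d, ‖∇²f(w)·∇f(w − α∇f(w)) − ∇²f(u)·∇f(u − α∇f(u))‖ ≤ (L² + ρ‖∇f(u)‖)(1 + αL) ‖w − u‖. -/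
/-- **Lipschitz-type bound for the Hessian–gradient product** (inequality
`term_2_bound`): for every `w, u`,
`‖∇²f(w)·∇f(w − α∇f(w)) − ∇²f(u)·∇f(u − α∇f(u))‖ ≤ (L² + ρ‖∇f(u)‖)(1 + αL)‖w − u‖`. -/
theorem hessian_gradient_product_lipschitz
    {d : ℕ} (f : EuclideanSpace ℝ (Fin d) → ℝ) (hf : ContDiff ℝ 2 f)
    (L ρ α : ℝ) (hL : 0 < L) (hρ : 0 < ρ) (hα : 0 ≤ α)
    (hgrad : ∀ w u, ‖gradient f w - gradient f u‖ ≤ L * ‖w - u‖)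
    (hhess : ∀ w u,
      ‖fderiv ℝ (gradient f) w - fderiv ℝ (gradient f) u‖ ≤ ρ * ‖w - u‖) :
    ∀ w u : EuclideanSpace ℝ (Fin d),
      ‖fderiv ℝ (gradient f) w (gradient f (w - α • gradient f w)) -
          fderiv ℝ (gradient f) u (gradient f (u - α • gradient f u))‖ ≤
        (L ^ 2 + ρ * ‖gradient f u‖) * (1 + α * L) * ‖w - u‖ := by
  intro w u
  have hH : ‖fderiv ℝ (gradient f) w‖ ≤ L :=
    norm_fderiv_le_of_lip' ℝ hL.le (Filter.Eventually.of_forall fun x => hgrad x w)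
  have hstep : ‖(w - α • gradient f w) - (u - α • gradient f u)‖ ≤ (1 + α * L) * ‖w - u‖ :=
    calc ‖(w - α • gradient f w) - (u - α • gradient f u)‖
        = ‖(w - u) - α • (gradient f w - gradient f u)‖ := by
          congr 1
          module
      _ ≤ ‖w - u‖ + ‖α • (gradient f w - gradient f u)‖ := norm_sub_le _ _
      _ = ‖w - u‖ + α * ‖gradient f w - gradient f u‖ := by
          rw [norm_smul, Real.norm_of_nonneg hα]
      _ ≤ ‖w - u‖ + α * (L * ‖w - u‖) := by gcongr; exact hgrad w u
      _ = (1 + α * L) * ‖w - u‖ := by ring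
  have hgrad_step : ‖gradient f (u - α • gradient f u)‖ ≤ (1 + α * L) * ‖gradient f u‖ := by
    have h := hgrad (u - α • gradient f u) u
    rw [sub_sub_cancel_left, norm_neg, norm_smul, Real.norm_of_nonneg hα] at h
    linarith [norm_le_norm_add_norm_sub' (gradient f (u - α • gradient f u)) (gradient f u)]
  calc ‖fderiv ℝ (gradient f) w (gradient f (w - α • gradient f w)) -
          fderiv ℝ (gradient f) u (gradient f (u - α • gradient f u))‖
      = ‖fderiv ℝ (gradient f) w
            (gradient f (w - α • gradient f w) - gradient f (u - α • gradient f u)) +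
          (fderiv ℝ (gradient f) w - fderiv ℝ (gradient f) u)
            (gradient f (u - α • gradient f u))‖ := by
        rw [map_sub, sub_apply, sub_add_sub_cancel]
    _ ≤ ‖fderiv ℝ (gradient f) w‖ *
            ‖gradient f (w - α • gradient f w) - gradient f (u - α • gradient f u)‖ +
          ‖fderiv ℝ (gradient f) w - fderiv ℝ (gradient f) u‖ *
            ‖gradient f (u - α • gradient f u)‖ :=
        norm_add_le_of_le (ContinuousLinearMap.le_opNorm _ _) (ContinuousLinearMap.le_opNorm _ _)
    _ ≤ L * (L * ((1 + α * L) * ‖w - u‖)) +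
          ρ * ‖w - u‖ * ((1 + α * L) * ‖gradient f u‖) := by
        gcongr
        · exact (hgrad _ _).trans (by gcongr)
        · exact hhess w u
    _ = (L ^ 2 + ρ * ‖gradient f u‖) * (1 + α * L) * ‖w - u‖ := by ring
end

section
/- The gradient of the stochastic meta-objective differs from the exact one by at most ‖E[(I − αH)·∇f(w − αg)] − (I − α∇²f(w))·∇f(w − α∇f(w))‖ ≤ 2αL σ̃/√D + α² L σ_H σ̃ / D. -/
open MeasureTheory

/-- **Cauchy–Schwarz for integrals**, with explicit bounds on the second moments. -/
theorem integral_mul_le_of_integral_sq_le {Ω : Type*} [MeasurableSpace Ω] {μ : Measure Ω}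
    {a b : Ω → ℝ} (ha0 : ∀ ω, 0 ≤ a ω) (hb0 : ∀ ω, 0 ≤ b ω)
    (ha : MemLp a 2 μ) (hb : MemLp b 2 μ) {s t : ℝ} (hs : 0 ≤ s) (ht : 0 ≤ t)
    (has : ∫ ω, a ω ^ 2 ∂μ ≤ s ^ 2) (hbt : ∫ ω, b ω ^ 2 ∂μ ≤ t ^ 2) :
    ∫ ω, a ω * b ω ∂μ ≤ s * t := by
  have h := integral_mul_le_Lp_mul_Lq_of_nonneg (μ := μ) Real.HolderConjugate.two_two
    (Filter.Eventually.of_forall ha0) (Filter.Eventually.of_forall hb0)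
    (by simpa using ha) (by simpa using hb)
  simp only [Real.rpow_two, ← Real.sqrt_eq_rpow] at h
  exact h.trans (mul_le_mul (Real.sqrt_le_iff.2 ⟨hs, has⟩) (Real.sqrt_le_iff.2 ⟨ht, hbt⟩)
    (Real.sqrt_nonneg _) hs)

/-- **Difference between the stochastic and exact meta-gradients** (Theorem
`Thm_F_hatF`, single-task version):
`‖E[(I − αH)∇f(w − αg)] − (I − α∇²f(w))∇f(w − α∇f(w))‖ ≤ 2αLσ̃/√D + α²Lσ_Hσ̃/D`. -/
theorem stochastic_meta_gradient_bias
    {d : ℕ} (f : EuclideanSpace ℝ (Fin d) → ℝ) (hf : ContDiff ℝ 2 f)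
    (L α σt σH D : ℝ) (hL : 0 < L) (hα0 : 0 < α) (hα : α ≤ 1 / L)
    (hσt : 0 ≤ σt) (hσH : 0 ≤ σH) (hD : 0 < D)
    (hgrad : ∀ w u, ‖gradient f w - gradient f u‖ ≤ L * ‖w - u‖)
    (w : EuclideanSpace ℝ (Fin d))
    {Ω : Type*} [MeasureSpace Ω] [IsProbabilityMeasure (volume : Measure Ω)]
    (g : Ω → EuclideanSpace ℝ (Fin d))
    (H : Ω → EuclideanSpace ℝ (Fin d) →L[ℝ] EuclideanSpace ℝ (Fin d))
    (hgint : Integrable g) (hHint : Integrable H)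
    (hgmean : ∫ ω, g ω = gradient f w)
    (hgsq : Integrable (fun ω => ‖g ω - gradient f w‖ ^ 2))
    (hgvar : ∫ ω, ‖g ω - gradient f w‖ ^ 2 ≤ σt ^ 2 / D)
    (hHmean : ∫ ω, H ω = fderiv ℝ (gradient f) w)
    (hHsq : Integrable (fun ω => ‖H ω - fderiv ℝ (gradient f) w‖ ^ 2))
    (hHvar : ∫ ω, ‖H ω - fderiv ℝ (gradient f) w‖ ^ 2 ≤ σH ^ 2 / D)
    (hprod : Integrable (fun ω =>
      (ContinuousLinearMap.id ℝ (EuclideanSpace ℝ (Fin d)) - α • H ω)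
        (gradient f (w - α • g ω)))) :
    ‖(∫ ω, (ContinuousLinearMap.id ℝ (EuclideanSpace ℝ (Fin d)) - α • H ω)
          (gradient f (w - α • g ω))) -
        (ContinuousLinearMap.id ℝ (EuclideanSpace ℝ (Fin d)) -
            α • fderiv ℝ (gradient f) w)
          (gradient f (w - α • gradient f w))‖ ≤
      2 * α * L * σt / Real.sqrt D + α ^ 2 * L * σH * σt / D := by
  set G := gradient f w
  set K := fderiv ℝ (gradient f) w
  set c := gradient f (w - α • G)
  set I := ContinuousLinearMap.id ℝ (EuclideanSpace ℝ (Fin d))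
  have hK : ‖K‖ ≤ L := by
    have hlip : LipschitzWith L.toNNReal (gradient f) :=
      LipschitzWith.of_dist_le_mul fun x y => by
        simpa only [dist_eq_norm, Real.coe_toNNReal _ hL.le] using hgrad x y
    simpa only [Real.coe_toNNReal _ hL.le] using norm_fderiv_le_of_lipschitz ℝ hlip (x₀ := w)
  have hαL : α * L ≤ 1 := (le_div_iff₀ hL).1 hα
  have hA : ‖I - α • K‖ ≤ 2 := by
    have hαK : ‖α • K‖ ≤ 1 := by
      rw [norm_smul, Real.norm_of_nonneg hα0.le]
      exact (mul_le_mul_of_nonneg_left hK hα0.le).trans hαL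
    calc ‖I - α • K‖ ≤ ‖I‖ + ‖α • K‖ := norm_sub_le _ _
      _ ≤ 1 + 1 := add_le_add ContinuousLinearMap.norm_id_le hαK
      _ = 2 := by norm_num
  have hgL : MemLp (fun ω => ‖g ω - G‖) 2 volume :=
    (memLp_two_iff_integrable_sq
      (hgint.aestronglyMeasurable.sub aestronglyMeasurable_const).norm).2 hgsq
  have hHL : MemLp (fun ω => ‖H ω - K‖) 2 volume :=
    (memLp_two_iff_integrable_sq
      (hHint.aestronglyMeasurable.sub aestronglyMeasurable_const).norm).2 hHsq
  have hgi : Integrable (fun ω => ‖g ω - G‖) := (hgint.sub (integrable_const G)).norm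
  have hmi : Integrable (fun ω => ‖H ω - K‖ * ‖g ω - G‖) := hHL.integrable_mul hgL
  have hsq (s : ℝ) : (s / √D) ^ 2 = s ^ 2 / D := by rw [div_pow, Real.sq_sqrt hD.le]
  have hst : 0 ≤ σt / √D := by positivity
  have hsH : 0 ≤ σH / √D := by positivity
  have hg1 : ∫ ω, ‖g ω - G‖ ≤ σt / √D := by
    simpa using integral_mul_le_of_integral_sq_le (fun ω => norm_nonneg (g ω - G))
      (fun _ => zero_le_one) hgL (memLp_const (1 : ℝ)) hst zero_le_one
      (by rw [hsq]; exact hgvar) (by simp)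
  have hHg : ∫ ω, ‖H ω - K‖ * ‖g ω - G‖ ≤ σH / √D * (σt / √D) :=
    integral_mul_le_of_integral_sq_le (fun _ => norm_nonneg _) (fun _ => norm_nonneg _)
      hHL hgL hsH hst (by rw [hsq]; exact hHvar) (by rw [hsq]; exact hgvar)
  have hBi : Integrable (fun ω => I - α • H ω) := (integrable_const I).sub (hHint.smul α)
  have hBmean : ∫ ω, (I - α • H ω) c = (I - α • K) c := by
    have hsmul : Integrable (fun ω => α • H ω) := hHint.smul α
    rw [← ContinuousLinearMap.integral_apply hBi, integral_sub (integrable_const I) hsmul,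
      integral_smul, hHmean]
    simp
  have hpt (ω : Ω) :
      ‖(I - α • H ω) (gradient f (w - α • g ω)) - (I - α • H ω) c‖ ≤
        2 * α * L * ‖g ω - G‖ + α ^ 2 * L * (‖H ω - K‖ * ‖g ω - G‖) := by
    have he : ‖gradient f (w - α • g ω) - c‖ ≤ L * (α * ‖g ω - G‖) := by
      refine (hgrad _ _).trans_eq ?_
      rw [sub_sub_sub_cancel_left, ← smul_sub, norm_smul, Real.norm_of_nonneg hα0.le,
        norm_sub_rev]
    have hB : ‖I - α • H ω‖ ≤ 2 + α * ‖H ω - K‖ := by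
      have hdecomp : I - α • H ω = (I - α • K) - α • (H ω - K) := by
        rw [smul_sub]; abel
      rw [hdecomp]
      refine (norm_sub_le _ _).trans (add_le_add hA ?_)
      rw [norm_smul, Real.norm_of_nonneg hα0.le]
    rw [← map_sub]
    calc _ ≤ ‖I - α • H ω‖ * ‖gradient f (w - α • g ω) - c‖ :=
          ContinuousLinearMap.le_opNorm _ _
      _ ≤ (2 + α * ‖H ω - K‖) * (L * (α * ‖g ω - G‖)) := by gcongr
      _ = _ := by ring
  rw [← hBmean, ← integral_sub hprod (hBi.apply_continuousLinearMap c)]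
  calc _ ≤ ∫ ω, (2 * α * L * ‖g ω - G‖ + α ^ 2 * L * (‖H ω - K‖ * ‖g ω - G‖)) :=
        norm_integral_le_of_norm_le ((hgi.const_mul _).add (hmi.const_mul _))
          (Filter.Eventually.of_forall hpt)
    _ = 2 * α * L * (∫ ω, ‖g ω - G‖) +
          α ^ 2 * L * ∫ ω, ‖H ω - K‖ * ‖g ω - G‖ := by
        rw [integral_add (hgi.const_mul _) (hmi.const_mul _), integral_const_mul,
          integral_const_mul]
    _ ≤ 2 * α * L * (σt / √D) + α ^ 2 * L * (σH / √D * (σt / √D)) := by gcongr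
    _ = _ := by
        rw [div_mul_div_comm, Real.mul_self_sqrt hD.le]
        ring
end

section
/- The matrix S = (1/n) ∑_{i=1}^n (I − αA_i)² A_i is positive definite (in particular invertible), and the point w* = −S⁻¹ · ((1/n) ∑_{i=1}^n (I − αA_i)² b_i) is a stationary point of the quadratic meta-objective: ∇F(w*) = 0, where F(w) = (1/n) ∑_{i=1}^n f_i(w − α∇f_i(w)) with f_i(w) = (1/2)⟪w, A_i w⟫ + ⟪b_i, w⟫ + c_i. -/
open scoped RealInnerProductSpace BigOperators

section

variable {E : Type*} [NormedAddCommGroup E] [InnerProductSpace ℝ E]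

/-- The operator `1 - α • T` is injective when `α * ‖T‖ < 1`. -/
lemma one_sub_smul_apply_ne_zero {T : E →L[ℝ] E} {α L : ℝ} (hT : ‖T‖ ≤ L) (hα0 : 0 ≤ α)
    (hαL : α * L < 1) {v : E} (hv : v ≠ 0) : (1 - α • T) v ≠ 0 := by
  intro h
  have hfix : v = α • T v := by
    simpa [sub_eq_zero] using h
  have hle : ‖v‖ ≤ α * (L * ‖v‖) := by
    calc ‖v‖ = α * ‖T v‖ := by
          conv_lhs => rw [hfix]
          rw [norm_smul, Real.norm_of_nonneg hα0]
      _ ≤ α * (L * ‖v‖) := by gcongr; exact T.le_of_opNorm_le hT v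
  nlinarith [norm_pos_iff.mpr hv]

lemma isSymmetric_one_sub_smul {T : E →L[ℝ] E} (hT : ∀ v u, ⟪T v, u⟫ = ⟪v, T u⟫) (α : ℝ)
    (v u : E) : ⟪(1 - α • T) v, u⟫ = ⟪v, (1 - α • T) u⟫ := by
  simp [inner_sub_left, inner_sub_right, inner_smul_left, inner_smul_right, hT]

lemma inner_sq_mul_pos {P T : E →L[ℝ] E} (hP : ∀ v u, ⟪P v, u⟫ = ⟪v, P u⟫)
    (hPT : Commute P T) (hT : ∀ v, v ≠ 0 → 0 < ⟪v, T v⟫) {v : E} (hv : P v ≠ 0) :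
    0 < ⟪v, (P ^ 2 * T) v⟫ := by
  have h : P ^ 2 * T = P * (T * P) := by rw [pow_two, mul_assoc, hPT.eq]
  rw [h, mul_apply_eq_comp, ← hP]
  exact hT _ hv

lemma isUnit_of_inner_pos [FiniteDimensional ℝ E] {S : E →L[ℝ] E}
    (hS : ∀ v, v ≠ 0 → 0 < ⟪v, S v⟫) : IsUnit S := by
  have := FiniteDimensional.complete ℝ E
  have hinj : Function.Injective S := by
    refine (injective_iff_map_eq_zero S).mpr fun v hv => ?_
    by_contra hne
    simpa [hv] using hS v hne
  exact ContinuousLinearMap.isUnit_iff_bijective.mpr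
    ⟨hinj, LinearMap.injective_iff_surjective.mp
      (show Function.Injective (S : E →ₗ[ℝ] E) from hinj)⟩

variable [CompleteSpace E]

lemma hasGradientAt_quadratic {T : E →L[ℝ] E} (hT : ∀ v u, ⟪T v, u⟫ = ⟪v, T u⟫)
    (b : E) (c : ℝ) (w : E) :
    HasGradientAt (fun w => (1 / 2) * ⟪w, T w⟫ + ⟪b, w⟫ + c) (T w + b) w := by
  rw [hasGradientAt_iff_hasFDerivAt]
  refine (((((hasFDerivAt_id w).inner ℝ T.hasFDerivAt).const_mul (1 / 2 : ℝ)).add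
    (innerSL ℝ b).hasFDerivAt).add_const c).congr_fderiv ?_
  ext u
  simp [hT]
  rw [real_inner_comm, hT]
  ring

lemma HasGradientAt.comp_of_symmetric {f : E → ℝ} {g : E → E} {P : E →L[ℝ] E} {y w : E}
    (hP : ∀ v u, ⟪P v, u⟫ = ⟪v, P u⟫) (hf : HasGradientAt f y (g w)) (hg : HasFDerivAt g P w) :
    HasGradientAt (fun w => f (g w)) (P y) w := by
  rw [hasGradientAt_iff_hasFDerivAt] at hf ⊢
  refine (hf.comp w hg).congr_fderiv ?_
  ext u
  simp [hP]

/-- The gradient of a quadratic function after one gradient step. -/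
lemma hasGradientAt_quadratic_gradient_step {T : E →L[ℝ] E}
    (hT : ∀ v u, ⟪T v, u⟫ = ⟪v, T u⟫) {b : E} {c : ℝ} {f : E → ℝ}
    (hf : ∀ w, f w = (1 / 2) * ⟪w, T w⟫ + ⟪b, w⟫ + c) (α : ℝ) (w : E) :
    HasGradientAt (fun w => f (w - α • gradient f w))
      (((1 - α • T) ^ 2 * T : E →L[ℝ] E) w + ((1 - α • T) ^ 2 : E →L[ℝ] E) b) w := by
  have hgrad (w : E) : HasGradientAt f (T w + b) w := by
    rw [funext hf]
    exact hasGradientAt_quadratic hT b c w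
  have hstep : HasFDerivAt (fun w => w - α • gradient f w) (1 - α • T) w := by
    simp only [fun w => (hgrad w).gradient]
    exact (hasFDerivAt_id w).sub ((T.hasFDerivAt.add_const b).const_smul α)
  convert HasGradientAt.comp_of_symmetric (g := fun w => w - α • gradient f w)
    (isSymmetric_one_sub_smul hT α) (hgrad (w - α • gradient f w)) hstep using 1
  simp only [(hgrad w).gradient, pow_two, mul_apply_eq_comp, sub_apply, one_apply_eq_self,
    smul_apply, map_sub, map_add, map_smul, smul_sub, smul_add]
  abel

end

/-- **Solution of the MAML problem in the convex quadratic case** (Section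
`Qudratic_MAML`): `S = (1/n)∑ᵢ (I − αAᵢ)²Aᵢ` is positive definite (in particular
invertible), and `w* = −S⁻¹·((1/n)∑ᵢ (I − αAᵢ)² bᵢ)` is a stationary point of the
quadratic meta-objective `F(w) = (1/n)∑ᵢ fᵢ(w − α∇fᵢ(w))`, i.e. `∇F(w*) = 0`. -/
theorem maml_quadratic_stationary_point
    {d n : ℕ} (hn : 1 ≤ n)
    (A : Fin n → EuclideanSpace ℝ (Fin d) →L[ℝ] EuclideanSpace ℝ (Fin d))
    (b : Fin n → EuclideanSpace ℝ (Fin d)) (c : Fin n → ℝ)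
    (L α : ℝ) (hL : 0 < L)
    (hsa : ∀ i v u, ⟪(A i) v, u⟫ = ⟪v, (A i) u⟫)
    (hpos : ∀ i (v : EuclideanSpace ℝ (Fin d)), v ≠ 0 → 0 < ⟪v, (A i) v⟫)
    (hnorm : ∀ i, ‖A i‖ ≤ L)
    (hα0 : 0 < α) (hα : α < 1 / L)
    (f : Fin n → EuclideanSpace ℝ (Fin d) → ℝ)
    (hf : ∀ i w, f i w = (1 / 2) * ⟪w, (A i) w⟫ + ⟪b i, w⟫ + c i)
    (F : EuclideanSpace ℝ (Fin d) → ℝ)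
    (hF : ∀ w, F w = (n : ℝ)⁻¹ * ∑ i, f i (w - α • gradient (f i) w))
    (S : EuclideanSpace ℝ (Fin d) →L[ℝ] EuclideanSpace ℝ (Fin d))
    (hS : S = (n : ℝ)⁻¹ • ∑ i, ((1 - α • A i) ^ 2 * A i)) :
    (∀ v : EuclideanSpace ℝ (Fin d), v ≠ 0 → 0 < ⟪v, S v⟫) ∧ IsUnit S ∧
      gradient F (-(Ring.inverse S ((n : ℝ)⁻¹ • ∑ i, (((1 - α • A i) ^ 2 : EuclideanSpace ℝ (Fin d) →L[ℝ] EuclideanSpace ℝ (Fin d)) (b i))))) = 0 := by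
  have hαL : α * L < 1 := (lt_div_iff₀ hL).mp hα
  have hn0 : (0 : ℝ) < (n : ℝ)⁻¹ := by positivity
  have hSpos : ∀ v : EuclideanSpace ℝ (Fin d), v ≠ 0 → 0 < ⟪v, S v⟫ := by
    intro v hv
    rw [hS, smul_apply, sum_apply, inner_smul_right,
      inner_sum]
    refine mul_pos hn0 (Finset.sum_pos (fun i _ => ?_) ⟨⟨0, hn⟩, Finset.mem_univ _⟩)
    exact inner_sq_mul_pos (isSymmetric_one_sub_smul (hsa i) α)
      ((Commute.one_left _).sub_left ((Commute.refl _).smul_left α)) (hpos i)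
      (one_sub_smul_apply_ne_zero (hnorm i) hα0.le hαL hv)
  have hunit : IsUnit S := isUnit_of_inner_pos hSpos
  refine ⟨hSpos, hunit, ?_⟩
  set y := (n : ℝ)⁻¹ • ∑ i, ((1 - α • A i) ^ 2 : EuclideanSpace ℝ (Fin d) →L[ℝ] _) (b i) with hy
  have hgradF (w : EuclideanSpace ℝ (Fin d)) : HasGradientAt F (S w + y) w := by
    have hsum : S w + y = (n : ℝ)⁻¹ • ∑ i,
        (((1 - α • A i) ^ 2 * A i : EuclideanSpace ℝ (Fin d) →L[ℝ] _) w +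
          ((1 - α • A i) ^ 2 : EuclideanSpace ℝ (Fin d) →L[ℝ] _) (b i)) := by
      rw [hS, hy, smul_apply, sum_apply, Finset.sum_add_distrib, smul_add]
    rw [funext hF, hsum, hasGradientAt_iff_hasFDerivAt]
    refine ((HasFDerivAt.fun_sum fun i _ =>
      (hasGradientAt_quadratic_gradient_step (hsa i) (hf i) α w).hasFDerivAt).const_mul
        (n : ℝ)⁻¹).congr_fderiv ?_
    simp only [map_smulₛₗ, conj_trivial, map_sum]
  rw [(hgradF _).gradient, map_neg, ← mul_apply_eq_comp,
    Ring.mul_inverse_cancel S hunit, one_apply_eq_self, neg_add_cancel]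
end

section
/- For any initial point w_0 ∈ ℝ^d, the FO-MAML iterates defined by w_{k+1} = w_k − (α/n) ∑_{i=1}^n ( A_i (w_k − α(A_i w_k + b_i)) + b_i ), equivalently w_{k+1} = (I − αM) w_k − α·(1/n) ∑_{i=1}^n (I − αA_i) b_i with M = (1/n) ∑_{i=1}^n (I − αA_i)A_i, converge as k → ∞ to the point w_FO = −M⁻¹ · ((1/n) ∑_{i=1}^n (I − αA_i) b_i). -/
open scoped RealInnerProductSpace BigOperators

section

variable {E : Type*} [NormedAddCommGroup E] [InnerProductSpace ℝ E]

theorem two_sub_norm_mul_norm_sq_le_inner (S : E →L[ℝ] E)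
    (hsymm : ∀ v u, ⟪S v, u⟫ = ⟪v, S u⟫) (hnonneg : ∀ v, 0 ≤ ⟪v, S v⟫) (v : E) :
    (2 - ‖S‖) * ‖S v‖ ^ 2 ≤ ⟪v, S v⟫ := by
  have hquad := hnonneg (v - S v)
  have hbound : ⟪S v, S (S v)⟫ ≤ ‖S‖ * ‖S v‖ ^ 2 := by
    calc ⟪S v, S (S v)⟫ ≤ ‖S v‖ * ‖S (S v)‖ := real_inner_le_norm _ _
      _ ≤ ‖S v‖ * (‖S‖ * ‖S v‖) := by gcongr; exact S.le_opNorm _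
      _ = ‖S‖ * ‖S v‖ ^ 2 := by ring
  simp only [map_sub, inner_sub_left, inner_sub_right] at hquad
  rw [← hsymm v (S v), real_inner_self_eq_norm_sq] at hquad
  linarith

theorem norm_one_sub_apply_sq_le (S : E →L[ℝ] E)
    (hsymm : ∀ v u, ⟪S v, u⟫ = ⟪v, S u⟫) (hnonneg : ∀ v, 0 ≤ ⟪v, S v⟫)
    (hnorm : ‖S‖ ≤ 1) (v : E) :
    ‖(1 - S) v‖ ^ 2 ≤ ‖v‖ ^ 2 - ⟪v, S v⟫ := by
  have h := two_sub_norm_mul_norm_sq_le_inner S hsymm hnonneg v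
  have hexp : ‖(1 - S) v‖ ^ 2 = ‖v‖ ^ 2 - 2 * ⟪v, S v⟫ + ‖S v‖ ^ 2 := by
    simpa using norm_sub_sq_real v (S v)
  nlinarith [sq_nonneg ‖S v‖]

theorem norm_one_sub_le_one (S : E →L[ℝ] E)
    (hsymm : ∀ v u, ⟪S v, u⟫ = ⟪v, S u⟫) (hnonneg : ∀ v, 0 ≤ ⟪v, S v⟫)
    (hnorm : ‖S‖ ≤ 1) : ‖1 - S‖ ≤ 1 := by
  refine ContinuousLinearMap.opNorm_le_bound _ zero_le_one fun v => ?_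
  rw [one_mul]
  refine le_of_sq_le_sq ?_ (norm_nonneg _)
  linarith [norm_one_sub_apply_sq_le S hsymm hnonneg hnorm v, hnonneg v]

theorem inner_one_sub_mul_self_pos (S : E →L[ℝ] E)
    (hsymm : ∀ v u, ⟪S v, u⟫ = ⟪v, S u⟫) (hpos : ∀ v, v ≠ 0 → 0 < ⟪v, S v⟫)
    (hnorm : ‖S‖ < 1) {v : E} (hv : v ≠ 0) : 0 < ⟪v, ((1 - S) * S) v⟫ := by
  have hnonneg : ∀ v, 0 ≤ ⟪v, S v⟫ := fun v => by
    rcases eq_or_ne v 0 with rfl | h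
    · simp
    · exact (hpos v h).le
  have h := two_sub_norm_mul_norm_sq_le_inner S hsymm hnonneg v
  have hSv : 0 < ‖S v‖ := norm_pos_iff.2 fun h0 => by simpa [h0] using hpos v hv
  have hexp : ⟪v, ((1 - S) * S) v⟫ = ⟪v, S v⟫ - ‖S v‖ ^ 2 := by
    simp [inner_sub_right, ← hsymm v (S v)]
  nlinarith [pow_pos hSv 2]

theorem ContinuousLinearMap.norm_lt_one_of_forall_norm_apply_lt [FiniteDimensional ℝ E]
    (T : E →L[ℝ] E) (hT : ∀ v, v ≠ 0 → ‖T v‖ < ‖v‖) : ‖T‖ < 1 := by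
  have := FiniteDimensional.proper ℝ E
  obtain ⟨x, hx, hmax⟩ := (isCompact_closedBall (0 : E) 1).exists_isMaxOn
    ⟨0, by simp⟩ (f := fun v => ‖T v‖) (by fun_prop)
  have hlt : ‖T x‖ < 1 := by
    rcases eq_or_ne x 0 with rfl | h
    · simp
    · exact (hT x h).trans_le (by simpa using hx)
  refine (T.opNorm_le_of_unit_norm (norm_nonneg _) fun v hv => ?_).trans_lt hlt
  exact hmax (by simp [hv])

theorem norm_one_sub_lt_one [FiniteDimensional ℝ E] (S : E →L[ℝ] E)
    (hsymm : ∀ v u, ⟪S v, u⟫ = ⟪v, S u⟫) (hpos : ∀ v, v ≠ 0 → 0 < ⟪v, S v⟫)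
    (hnorm : ‖S‖ ≤ 1) : ‖1 - S‖ < 1 := by
  refine (1 - S).norm_lt_one_of_forall_norm_apply_lt fun v hv => ?_
  refine lt_of_pow_lt_pow_left₀ 2 (norm_nonneg _) ?_
  have hnonneg : ∀ v, 0 ≤ ⟪v, S v⟫ := fun v => by
    rcases eq_or_ne v 0 with rfl | h
    · simp
    · exact (hpos v h).le
  linarith [norm_one_sub_apply_sq_le S hsymm hnonneg hnorm v, hpos v hv]

theorem norm_one_sub_average_lt_one [FiniteDimensional ℝ E] {n : ℕ} (hn : 1 ≤ n)
    (B : Fin n → E →L[ℝ] E)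
    (hsymm : ∀ i v u, ⟪B i v, u⟫ = ⟪v, B i u⟫)
    (hpos : ∀ i v, v ≠ 0 → 0 < ⟪v, B i v⟫) (hnorm : ∀ i, ‖B i‖ < 1) :
    ‖1 - (n : ℝ)⁻¹ • ∑ i, (1 - B i) * B i‖ < 1 := by
  have hn0 : (0 : ℝ) < n := by exact_mod_cast hn
  have hnonneg : ∀ i v, 0 ≤ ⟪v, B i v⟫ := fun i v => by
    rcases eq_or_ne v 0 with rfl | h
    · simp
    · exact (hpos i v h).le
  refine norm_one_sub_lt_one _ (fun v u => ?_) (fun v hv => ?_) ?_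
  · simp [sum_inner, inner_sum, inner_smul_left, inner_smul_right, inner_sub_left,
      inner_sub_right, hsymm]
  · have : Nonempty (Fin n) := ⟨⟨0, hn⟩⟩
    rw [smul_apply, sum_apply, inner_smul_right, inner_sum]
    exact mul_pos (inv_pos.2 hn0) (Finset.sum_pos
      (fun i _ => inner_one_sub_mul_self_pos (B i) (hsymm i) (hpos i) (hnorm i) hv)
      Finset.univ_nonempty)
  · have hsum : ‖∑ i, (1 - B i) * B i‖ ≤ n := by
      refine (norm_sum_le_of_le (f := fun i => (1 - B i) * B i) Finset.univ (n := fun _ => 1)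
        fun i _ => (norm_mul_le _ _).trans ?_).trans (by simp)
      exact mul_le_one₀ (norm_one_sub_le_one (B i) (hsymm i) (hnonneg i) (hnorm i).le)
        (norm_nonneg _) (hnorm i).le
    rw [norm_smul, norm_inv, Real.norm_natCast]
    exact inv_mul_le_one_of_le₀ hsum hn0.le

theorem tendsto_of_affine_recursion (T : E →L[ℝ] E) (hT : ‖T‖ < 1) (w : ℕ → E) (x : E)
    (hrec : ∀ k, w (k + 1) - x = T (w k - x)) :
    Filter.Tendsto w Filter.atTop (nhds x) := by
  have hbound : ∀ k, ‖w k - x‖ ≤ ‖T‖ ^ k * ‖w 0 - x‖ := fun k => by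
    induction k with
    | zero => simp
    | succ k ih =>
      rw [hrec, pow_succ', mul_assoc]
      exact (T.le_opNorm _).trans (by gcongr)
  rw [tendsto_iff_norm_sub_tendsto_zero]
  refine squeeze_zero (fun _ => norm_nonneg _) hbound ?_
  simpa using (tendsto_pow_atTop_nhds_zero_of_lt_one (norm_nonneg T) hT).mul_const ‖w 0 - x‖

end

/-- **Limit of FO-MAML in the convex quadratic case** (equations
`w_FOMAML_quad`–`w_FOMAML_quad_2`): the iterates
`w_{k+1} = w_k − (α/n)∑ᵢ (Aᵢ(w_k − α(Aᵢw_k + bᵢ)) + bᵢ)` converge to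
`w_FO = −M⁻¹·((1/n)∑ᵢ (I − αAᵢ)bᵢ)`, where `M = (1/n)∑ᵢ (I − αAᵢ)Aᵢ`. -/
theorem fomaml_quadratic_limit
    {d n : ℕ} (hn : 1 ≤ n)
    (A : Fin n → EuclideanSpace ℝ (Fin d) →L[ℝ] EuclideanSpace ℝ (Fin d))
    (b : Fin n → EuclideanSpace ℝ (Fin d))
    (L α : ℝ) (hL : 0 < L)
    (hsa : ∀ i v u, ⟪(A i) v, u⟫ = ⟪v, (A i) u⟫)
    (hpos : ∀ i (v : EuclideanSpace ℝ (Fin d)), v ≠ 0 → 0 < ⟪v, (A i) v⟫)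
    (hnorm : ∀ i, ‖A i‖ ≤ L)
    (hα0 : 0 < α) (hα : α < 1 / L)
    (M : EuclideanSpace ℝ (Fin d) →L[ℝ] EuclideanSpace ℝ (Fin d))
    (hM : M = (n : ℝ)⁻¹ • ∑ i, ((1 - α • A i) * A i))
    (w : ℕ → EuclideanSpace ℝ (Fin d)) (w0 : EuclideanSpace ℝ (Fin d))
    (hw0 : w 0 = w0)
    (hrec : ∀ k, w (k + 1) =
      w k - (α / n) • ∑ i, ((A i) (w k - α • ((A i) (w k) + b i)) + b i)) :
    Filter.Tendsto w Filter.atTop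
      (nhds (-(Ring.inverse M
        ((n : ℝ)⁻¹ • ∑ i, (((1 - α • A i) : EuclideanSpace ℝ (Fin d) →L[ℝ]
            EuclideanSpace ℝ (Fin d)) (b i)))))) := by
  have hsmul : α • M = (n : ℝ)⁻¹ • ∑ i, (1 - α • A i) * (α • A i) := by
    rw [hM, smul_comm, Finset.smul_sum]
    congr 2 with i : 1
    ext1 v
    simp only [smul_apply, mul_apply_eq_comp, map_smul]
  have hT : ‖1 - α • M‖ < 1 := by
    rw [hsmul]
    refine norm_one_sub_average_lt_one hn (fun i => α • A i) (fun i v u => ?_)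
      (fun i v hv => ?_) fun i => ?_
    · simp [inner_smul_left, inner_smul_right, hsa]
    · simpa [inner_smul_right] using mul_pos hα0 (hpos i v hv)
    · rw [norm_smul, Real.norm_of_nonneg hα0.le]
      exact (mul_le_mul_of_nonneg_left (hnorm i) hα0.le).trans_lt ((lt_div_iff₀ hL).1 hα)
  have hunit : IsUnit M := by
    have h : IsUnit (α • M) := by simpa using isUnit_one_sub_of_norm_lt_one hT
    have hcomm : Commute (α • 1) M := by
      ext1 v
      simp only [smul_apply, mul_apply_eq_comp, one_apply_eq_self, map_smul]
    have hmul : α • M = (α • 1) * M := by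
      ext1 v
      simp only [smul_apply, mul_apply_eq_comp, one_apply_eq_self]
    exact (hcomm.isUnit_mul_iff.1 (hmul ▸ h)).2
  set c := (n : ℝ)⁻¹ • ∑ i, (1 - α • A i : EuclideanSpace ℝ (Fin d) →L[ℝ]
    EuclideanSpace ℝ (Fin d)) (b i) with hc
  have hfix : M (Ring.inverse M c) = c := by
    rw [← mul_apply_eq_comp, Ring.mul_inverse_cancel _ hunit,
      one_apply_eq_self]
  have hstep : ∀ k, w (k + 1) = w k - α • (M (w k) + c) := fun k => by
    rw [hrec, hM, hc, smul_apply, sum_apply, ← smul_add,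
      ← Finset.sum_add_distrib, smul_smul, ← div_eq_mul_inv]
    congr 2
    refine Finset.sum_congr rfl fun i _ => ?_
    simp only [map_sub, map_smul, map_add, mul_apply_eq_comp,
      sub_apply, one_apply_eq_self, smul_apply]
    module
  refine tendsto_of_affine_recursion (1 - α • M) hT w _ fun k => ?_
  rw [hstep]
  simp only [sub_apply, one_apply_eq_self,
    smul_apply, map_sub, map_neg, hfix]
  module
end
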